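/- For every irrational ρ ∈ (0,1), both (0, ρ) and (ρ, 0) are accumulation points of the set of extreme points of Λ_ρ, and no other point of ℝ² is an accumulation point of the set of extreme points of Λ_ρ. -/

import Mathlib

open Filter Topology

noncomputable def alphaSeq (ρ : ℝ) (n : ℕ) : ℝ := (⌈(n : ℝ) * ρ⌉ : ℝ) - (n : ℝ) * ρ

noncomputable def vecRho (ρ : ℝ) (m n : ℕ) : ℝ × ℝ :=
  ((⌈(m : ℝ) * ρ⌉ : ℝ) / ((m : ℝ) + (n : ℝ) + 1),
   (⌈(n : ℝ) * ρ⌉ : ℝ) / ((m : ℝ) + (n : ℝ) + 1))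

noncomputable def LambdaSet (ρ : ℝ) : Set (ℝ × ℝ) :=
  closure (convexHull ℝ
    ({((0 : ℝ), (0 : ℝ))} ∪
      {p : ℝ × ℝ | ∃ m n : ℕ, alphaSeq ρ m < ρ ∧ alphaSeq ρ n < ρ ∧ p = vecRho ρ m n}))

open Set

/-- The convex hull of the union of two compact convex sets is compact. -/
theorem IsCompact.convexHull_union_of_convex {E : Type*} [AddCommGroup E] [Module ℝ E]
    [TopologicalSpace E] [IsTopologicalAddGroup E] [ContinuousSMul ℝ E] {A B : Set E}
    (hA : IsCompact A) (hB : IsCompact B) (hA' : Convex ℝ A) (hB' : Convex ℝ B) :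
    IsCompact (convexHull ℝ (A ∪ B)) := by
  rcases A.eq_empty_or_nonempty with rfl | hAn
  · simpa [hB'.convexHull_eq] using hB
  rcases B.eq_empty_or_nonempty with rfl | hBn
  · simpa [hA'.convexHull_eq] using hA
  have himg : convexHull ℝ (A ∪ B) =
      (fun q : (E × E) × ℝ => (1 - q.2) • q.1.1 + q.2 • q.1.2) '' ((A ×ˢ B) ×ˢ Icc 0 1) := by
    rw [_root_.convexHull_union hAn hBn, hA'.convexHull_eq, hB'.convexHull_eq]
    ext x
    simp only [mem_convexJoin, segment_eq_image, mem_image, mem_prod, Prod.exists]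
    constructor
    · rintro ⟨a, ha, b, hb, t, ht, rfl⟩
      exact ⟨a, b, t, ⟨⟨ha, hb⟩, ht⟩, rfl⟩
    · rintro ⟨a, b, t, ⟨⟨ha, hb⟩, ht⟩, rfl⟩
      exact ⟨a, ha, b, hb, t, ht, rfl⟩
  rw [himg]
  exact ((hA.prod hB).prod isCompact_Icc).image (by fun_prop)

section FiniteUnionCompact

variable {E : Type*} [AddCommGroup E] [Module ℝ E] [TopologicalSpace E]
  [IsTopologicalAddGroup E] [ContinuousSMul ℝ E] [T2Space E] {S C : Set E}

theorem exists_convexHull_eq_closure_convexHull (hC : IsCompact C) (hC' : Convex ℝ C)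
    (hfin : (S \ C).Finite) :
    ∃ B ⊆ C, IsCompact (convexHull ℝ ((S \ C) ∪ B)) ∧
      closure (convexHull ℝ S) = convexHull ℝ ((S \ C) ∪ B) := by
  have hBC : closure (convexHull ℝ (S ∩ C)) ⊆ C :=
    closure_minimal (convexHull_min inter_subset_right hC') hC.isClosed
  have hcomp : IsCompact (convexHull ℝ ((S \ C) ∪ closure (convexHull ℝ (S ∩ C)))) := by
    rw [← convexHull_convexHull_union_left]
    exact hfin.isCompact_convexHull (𝕜 := ℝ) |>.convexHull_union_of_convex
      (hC.of_isClosed_subset isClosed_closure hBC) (convex_convexHull ℝ _)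
      (convex_convexHull ℝ _).closure
  refine ⟨_, hBC, hcomp, Subset.antisymm ?_ ?_⟩
  · refine closure_minimal (convexHull_min (fun x hx => subset_convexHull ℝ _ ?_)
      (convex_convexHull ℝ _)) hcomp.isClosed
    by_cases hxC : x ∈ C
    · exact Or.inr (subset_closure (subset_convexHull ℝ _ ⟨hx, hxC⟩))
    · exact Or.inl ⟨hx, hxC⟩
  · refine convexHull_min (union_subset ?_ ?_) (convex_convexHull ℝ _).closure
    · exact sdiff_subset.trans ((subset_convexHull ℝ _).trans subset_closure)
    · exact closure_mono (convexHull_mono inter_subset_left)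

theorem isCompact_closure_convexHull_of_finite_diff (hC : IsCompact C) (hC' : Convex ℝ C)
    (hfin : (S \ C).Finite) : IsCompact (closure (convexHull ℝ S)) := by
  obtain ⟨B, -, hB, h⟩ := exists_convexHull_eq_closure_convexHull hC hC' hfin
  rwa [h]

theorem extremePoints_closure_convexHull_subset_of_finite_diff (hC : IsCompact C)
    (hC' : Convex ℝ C) (hfin : (S \ C).Finite) :
    (closure (convexHull ℝ S)).extremePoints ℝ ⊆ (S \ C) ∪ C := by
  obtain ⟨B, hBC, -, h⟩ := exists_convexHull_eq_closure_convexHull hC hC' hfin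
  rw [h]
  exact extremePoints_convexHull_subset.trans (union_subset_union_right _ hBC)

end FiniteUnionCompact

/-- The points whose closed convex hull is `LambdaSet ρ`. -/
def lambdaGenerators (ρ : ℝ) : Set (ℝ × ℝ) :=
  {((0 : ℝ), (0 : ℝ))} ∪
    {p : ℝ × ℝ | ∃ m n : ℕ, alphaSeq ρ m < ρ ∧ alphaSeq ρ n < ρ ∧ p = vecRho ρ m n}

/-- The part of the closed quadrant at which the sum of coordinates is `δ`-close to `ρ`. -/
def quadrantBand (ρ δ : ℝ) : Set (ℝ × ℝ) :=
  {p | 0 ≤ p.1 ∧ 0 ≤ p.2 ∧ |p.1 + p.2 - ρ| ≤ δ}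

theorem alphaSeq_nonneg (ρ : ℝ) (n : ℕ) : 0 ≤ alphaSeq ρ n :=
  sub_nonneg.2 (Int.le_ceil _)

theorem ceil_eq_add_alphaSeq (ρ : ℝ) (n : ℕ) : (⌈(n : ℝ) * ρ⌉ : ℝ) = n * ρ + alphaSeq ρ n := by
  simp [alphaSeq]

theorem vecRho_eq (ρ : ℝ) (m n : ℕ) :
    vecRho ρ m n = ((m * ρ + alphaSeq ρ m) / ((m : ℝ) + n + 1),
      (n * ρ + alphaSeq ρ n) / ((m : ℝ) + n + 1)) := by
  simp only [vecRho, ceil_eq_add_alphaSeq]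

theorem vecRho_fst_add_snd (ρ : ℝ) (m n : ℕ) :
    (vecRho ρ m n).1 + (vecRho ρ m n).2 - ρ =
      (alphaSeq ρ m + alphaSeq ρ n - ρ) / ((m : ℝ) + n + 1) := by
  have : (0 : ℝ) < (m : ℝ) + n + 1 := by positivity
  rw [vecRho_eq]
  field_simp
  ring

theorem isClosed_quadrantBand (ρ δ : ℝ) : IsClosed (quadrantBand ρ δ) :=
  (isClosed_le continuous_const continuous_fst).inter <|
    (isClosed_le continuous_const continuous_snd).inter <|
      isClosed_le (f := fun p : ℝ × ℝ => |p.1 + p.2 - ρ|) (by fun_prop) continuous_const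

theorem isCompact_quadrantBand (ρ δ : ℝ) : IsCompact (quadrantBand ρ δ) := by
  refine (isCompact_Icc.prod isCompact_Icc : IsCompact (Icc 0 (ρ + δ) ×ˢ Icc 0 (ρ + δ)))
    |>.of_isClosed_subset (isClosed_quadrantBand ρ δ) ?_
  rintro ⟨x, y⟩ ⟨hx, hy, h⟩
  simp only [abs_le] at hx hy h
  simp only [mem_prod, mem_Icc]
  exact ⟨⟨hx, by linarith⟩, hy, by linarith⟩

theorem convex_quadrantBand (ρ δ : ℝ) : Convex ℝ (quadrantBand ρ δ) := by
  rintro ⟨x, y⟩ ⟨hx, hy, h⟩ ⟨x', y'⟩ ⟨hx', hy', h'⟩ a b ha hb hab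
  obtain rfl : b = 1 - a := by linarith
  simp only [abs_le] at hx hy h hx' hy' h'
  refine ⟨?_, ?_, abs_le.2 ⟨?_, ?_⟩⟩ <;> simp only [Prod.smul_mk, Prod.mk_add_mk, smul_eq_mul]
  · positivity
  · positivity
  · nlinarith
  · nlinarith

theorem vecRho_nonneg {ρ : ℝ} (h0 : 0 < ρ) (m n : ℕ) :
    0 ≤ (vecRho ρ m n).1 ∧ 0 ≤ (vecRho ρ m n).2 := by
  have hm := alphaSeq_nonneg ρ m
  have hn := alphaSeq_nonneg ρ n
  rw [vecRho_eq]
  exact ⟨by positivity, by positivity⟩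

theorem finite_lambdaGenerators_diff {ρ δ : ℝ} (h0 : 0 < ρ) (hδ : 0 < δ) :
    (lambdaGenerators ρ \ quadrantBand ρ δ).Finite := by
  obtain ⟨N, hN⟩ := exists_nat_gt (ρ / δ)
  refine (((Set.finite_Iio N).image2 (vecRho ρ) (Set.finite_Iio N)).insert (0, 0)).subset ?_
  rintro p ⟨rfl | ⟨m, n, hm, hn, rfl⟩, hp⟩
  · exact mem_insert _ _
  refine mem_insert_of_mem _ (mem_image2_of_mem ?_ ?_) <;>
  · by_contra hlt
    simp only [mem_Iio, not_lt] at hlt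
    apply hp
    have hlt' : (N : ℝ) ≤ (m : ℝ) + n := by
      have : N ≤ m + n := by omega
      exact_mod_cast this
    have hD : (0 : ℝ) < (m : ℝ) + n + 1 := by positivity
    have h2 : ρ < N * δ := (div_lt_iff₀ hδ).1 hN
    have h3 := alphaSeq_nonneg ρ m
    have h4 := alphaSeq_nonneg ρ n
    refine ⟨(vecRho_nonneg h0 m n).1, (vecRho_nonneg h0 m n).2, ?_⟩
    rw [vecRho_fst_add_snd, abs_div, abs_of_pos hD, div_le_iff₀ hD, abs_le]
    constructor <;> nlinarith

theorem lambdaSet_eq (ρ : ℝ) : LambdaSet ρ = closure (convexHull ℝ (lambdaGenerators ρ)) := rfl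

theorem isCompact_lambdaSet {ρ : ℝ} (h0 : 0 < ρ) : IsCompact (LambdaSet ρ) :=
  isCompact_closure_convexHull_of_finite_diff (isCompact_quadrantBand ρ 1)
    (convex_quadrantBand ρ 1) (finite_lambdaGenerators_diff h0 one_pos)

theorem convex_lambdaSet (ρ : ℝ) : Convex ℝ (LambdaSet ρ) :=
  (convex_convexHull ℝ _).closure

theorem lambdaGenerators_subset (ρ : ℝ) : lambdaGenerators ρ ⊆ LambdaSet ρ :=
  (subset_convexHull ℝ _).trans subset_closure

theorem extremePoints_lambdaSet_subset {ρ δ : ℝ} (h0 : 0 < ρ) (hδ : 0 < δ) :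
    (LambdaSet ρ).extremePoints ℝ ⊆ (lambdaGenerators ρ \ quadrantBand ρ δ) ∪ quadrantBand ρ δ :=
  extremePoints_closure_convexHull_subset_of_finite_diff (isCompact_quadrantBand ρ δ)
    (convex_quadrantBand ρ δ) (finite_lambdaGenerators_diff h0 hδ)

theorem mem_quadrantBand_zero {ρ : ℝ} {x : ℝ × ℝ} (h : ∀ δ > 0, x ∈ quadrantBand ρ δ) :
    x ∈ quadrantBand ρ 0 :=
  ⟨(h 1 one_pos).1, (h 1 one_pos).2.1,
    le_of_forall_pos_le_add fun δ hδ => by simpa using (h δ hδ).2.2⟩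

theorem closure_extremePoints_lambdaSet_subset {ρ : ℝ} (h0 : 0 < ρ) :
    closure ((LambdaSet ρ).extremePoints ℝ) ⊆ lambdaGenerators ρ ∪ quadrantBand ρ 0 := by
  intro x hx
  by_contra hne
  rw [mem_union, not_or] at hne
  refine hne.2 (mem_quadrantBand_zero fun δ hδ => ?_)
  have := closure_minimal (extremePoints_lambdaSet_subset h0 hδ)
    ((finite_lambdaGenerators_diff h0 hδ).isClosed.union (isClosed_quadrantBand ρ δ)) hx
  exact this.resolve_left fun h => hne.1 h.1

theorem mem_quadrantBand_of_accPt {ρ : ℝ} (h0 : 0 < ρ) {x : ℝ × ℝ}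
    (hx : AccPt x (𝓟 ((LambdaSet ρ).extremePoints ℝ))) : x ∈ quadrantBand ρ 0 := by
  refine mem_quadrantBand_zero fun δ hδ => ?_
  have h := hx.mono (principal_mono.2 (extremePoints_lambdaSet_subset h0 hδ))
  rw [← sup_principal, accPt_sup] at h
  rcases h with h | h
  · exact absurd (finite_lambdaGenerators_diff h0 hδ) (Set.Infinite.of_accPt h)
  · exact (isClosed_quadrantBand ρ δ).closure_subset (mem_closure_iff_clusterPt.2 h.clusterPt)

theorem exists_alphaSeq_mem_Ioo {ρ a : ℝ} (hirr : Irrational ρ) (h1 : ρ < 1) (ha : 0 ≤ a)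
    (haρ : a < ρ) : ∃ n : ℕ, a < alphaSeq ρ n ∧ alphaSeq ρ n < ρ := by
  have hd : Dense (AddSubmonoid.closure {((-ρ : ℝ) : AddCircle (1 : ℝ))} :
      Set (AddCircle (1 : ℝ))) := by
    rw [dense_addSubmonoidClosure_iff_addSubgroupClosure, ← AddSubgroup.zmultiples_eq_closure,
      AddSubgroup.coe_zmultiples]
    exact AddCircle.denseRange_zsmul_coe_iff.2 (by simpa using hirr.neg)
  obtain ⟨_, hmem, y, hy, rfl⟩ := hd.exists_mem_open
    (QuotientAddGroup.isOpenMap_coe (N := AddSubgroup.zmultiples (1 : ℝ)) _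
      (isOpen_Ioo (a := a) (b := ρ))) ((nonempty_Ioo.2 haρ).image _)
  obtain ⟨n, hn⟩ := AddSubmonoid.mem_closure_singleton.1 hmem
  have hn' : (((n : ℝ) * -ρ : ℝ) : AddCircle (1 : ℝ)) = (y : AddCircle (1 : ℝ)) := by
    rw [← nsmul_eq_mul]
    exact hn
  obtain ⟨k, hk⟩ := AddSubgroup.mem_zmultiples_iff.1 (QuotientAddGroup.eq.1 hn')
  have hky : (k : ℝ) = n * ρ + y := by
    simp only [zsmul_eq_mul, mul_one] at hk
    linarith
  have hceil : ⌈(n : ℝ) * ρ⌉ = k := by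
    rw [Int.ceil_eq_iff]
    constructor <;> linarith [hy.1, hy.2]
  refine ⟨n, ?_⟩
  have hα : alphaSeq ρ n = y := by rw [alphaSeq, hceil, hky]; ring
  rw [hα]
  exact hy

theorem vecRho_mem_lambdaSet {ρ : ℝ} {m n : ℕ} (hm : alphaSeq ρ m < ρ) (hn : alphaSeq ρ n < ρ) :
    vecRho ρ m n ∈ LambdaSet ρ :=
  lambdaGenerators_subset ρ (Or.inr ⟨m, n, hm, hn, rfl⟩)

theorem zero_mem_lambdaSet (ρ : ℝ) : ((0 : ℝ), (0 : ℝ)) ∈ LambdaSet ρ :=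
  lambdaGenerators_subset ρ (Or.inl rfl)

theorem swap_image_lambdaGenerators (ρ : ℝ) :
    Prod.swap '' lambdaGenerators ρ = lambdaGenerators ρ := by
  have hsub : Prod.swap '' lambdaGenerators ρ ⊆ lambdaGenerators ρ := by
    rintro _ ⟨p, rfl | ⟨m, n, hm, hn, rfl⟩, rfl⟩
    · exact Or.inl rfl
    · refine Or.inr ⟨n, m, hn, hm, ?_⟩
      simp [vecRho, add_comm (m : ℝ)]
  refine hsub.antisymm ?_
  simpa [← image_comp] using image_mono (f := Prod.swap) hsub

theorem swap_image_lambdaSet (ρ : ℝ) : Prod.swap '' LambdaSet ρ = LambdaSet ρ := by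
  have h := (Homeomorph.prodComm ℝ ℝ).image_closure (convexHull ℝ (lambdaGenerators ρ))
  have h2 := (LinearEquiv.prodComm ℝ ℝ ℝ).toLinearMap.image_convexHull (lambdaGenerators ρ)
  have e1 : ⇑(Homeomorph.prodComm ℝ ℝ) = Prod.swap := rfl
  have e2 : ⇑(LinearEquiv.prodComm ℝ ℝ ℝ).toLinearMap = Prod.swap := rfl
  rw [e1] at h
  rw [e2, swap_image_lambdaGenerators] at h2
  rw [lambdaSet_eq, h, h2]

theorem zero_rho_mem_lambdaSet {ρ : ℝ} (hirr : Irrational ρ) (h0 : 0 < ρ) (h1 : ρ < 1) :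
    ((0 : ℝ), ρ) ∈ LambdaSet ρ := by
  refine isClosed_closure.closure_subset (Metric.mem_closure_iff.2 fun ε hε => ?_)
  obtain ⟨n, hn, hn'⟩ := exists_alphaSeq_mem_Ioo hirr h1 (le_max_right (ρ - ε) 0)
    (max_lt (by linarith) h0)
  have hα : alphaSeq ρ 0 = 0 := by simp [alphaSeq]
  refine ⟨vecRho ρ 0 n, vecRho_mem_lambdaSet (by rwa [hα]) hn', ?_⟩
  have hfst : (vecRho ρ 0 n).1 = 0 := by simp [vecRho]
  have hsum := vecRho_fst_add_snd ρ 0 n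
  rw [hfst, hα] at hsum
  have hlt : ρ - ε < alphaSeq ρ n := (le_max_left _ _).trans_lt hn
  have hD : (1 : ℝ) ≤ ((0 : ℕ) : ℝ) + n + 1 := by
    have := Nat.cast_nonneg (α := ℝ) n
    push_cast
    linarith
  rw [Prod.dist_eq, hfst, dist_self, Real.dist_eq, abs_sub_comm, max_lt_iff]
  refine ⟨hε, ?_⟩
  rw [show (vecRho ρ 0 n).2 - ρ = 0 + (vecRho ρ 0 n).2 - ρ by ring, hsum, abs_div,
    abs_of_pos (by linarith : (0 : ℝ) < ((0 : ℕ) : ℝ) + n + 1), div_lt_iff₀ (by linarith), abs_lt]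
  constructor <;> nlinarith

theorem rho_zero_mem_lambdaSet {ρ : ℝ} (hirr : Irrational ρ) (h0 : 0 < ρ) (h1 : ρ < 1) :
    (ρ, (0 : ℝ)) ∈ LambdaSet ρ := by
  rw [← swap_image_lambdaSet]
  exact ⟨_, zero_rho_mem_lambdaSet hirr h0 h1, rfl⟩

theorem Convex.smul_add_smul_mem_of_zero_mem {E : Type*} [AddCommGroup E] [Module ℝ E]
    {s : Set E} (hs : Convex ℝ s) (h0 : (0 : E) ∈ s) {x y : E} (hx : x ∈ s) (hy : y ∈ s)
    {a b : ℝ} (ha : 0 ≤ a) (hb : 0 ≤ b) (hab : a + b ≤ 1) : a • x + b • y ∈ s := by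
  rcases (add_nonneg ha hb).eq_or_lt with h | h
  · obtain rfl : a = 0 := by linarith
    obtain rfl : b = 0 := by linarith
    simpa using h0
  · have hmem : (a / (a + b)) • x + (b / (a + b)) • y ∈ s :=
      hs hx hy (by positivity) (by positivity) (by field_simp)
    have := hs.smul_mem_of_zero_mem h0 hmem ⟨h.le, hab⟩
    rwa [smul_add, smul_smul, smul_smul, mul_div_cancel₀ _ h.ne', mul_div_cancel₀ _ h.ne'] at this

theorem exists_diagonal_mem_lambdaSet {ρ : ℝ} (hirr : Irrational ρ) (h0 : 0 < ρ) (h1 : ρ < 1) :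
    ∃ c, ρ < 2 * c ∧ (c, c) ∈ LambdaSet ρ := by
  obtain ⟨n, hn, hn'⟩ := exists_alphaSeq_mem_Ioo hirr h1 (half_pos h0).le (half_lt_self h0)
  refine ⟨(vecRho ρ n n).1, ?_, vecRho_mem_lambdaSet hn' hn'⟩
  have hsum := vecRho_fst_add_snd ρ n n
  have hsnd : (vecRho ρ n n).2 = (vecRho ρ n n).1 := rfl
  have hpos : 0 < (alphaSeq ρ n + alphaSeq ρ n - ρ) / ((n : ℝ) + n + 1) :=
    div_pos (by linarith) (by positivity)
  rw [hsnd] at hsum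
  linarith

/-- A convex set containing `0`, `(0, ρ)` and `(c, c)` contains the triangle they span. -/
theorem Convex.mem_of_le_of_mem_triangle {s : Set (ℝ × ℝ)} (hs : Convex ℝ s)
    (hz : ((0 : ℝ), (0 : ℝ)) ∈ s) {ρ c x y : ℝ} (h0 : 0 < ρ) (hc : 0 < c)
    (hρ : ((0 : ℝ), ρ) ∈ s) (hcc : (c, c) ∈ s) (hx : 0 ≤ x) (hxy : x ≤ y)
    (hlt : c * y ≤ c * ρ + (c - ρ) * x) : (x, y) ∈ s := by
  have h := hs.smul_add_smul_mem_of_zero_mem hz hcc hρ (a := x / c) (b := (y - x) / ρ)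
    (by positivity) (div_nonneg (by linarith) h0.le) (by
      rw [div_add_div _ _ hc.ne' h0.ne', div_le_one (by positivity)]
      linarith)
  convert h using 1
  simp only [Prod.smul_mk, smul_eq_mul, Prod.mk_add_mk, mul_zero, add_zero]
  ext <;> field_simp
  ring

theorem mem_interior_lambdaSet {ρ : ℝ} (hirr : Irrational ρ) (h0 : 0 < ρ) (h1 : ρ < 1)
    {x : ℝ × ℝ} (hx : 0 < x.1) (hy : 0 < x.2) (hxy : x.1 + x.2 = ρ) :
    x ∈ interior (LambdaSet ρ) := by
  obtain ⟨c, hc, hcmem⟩ := exists_diagonal_mem_lambdaSet hirr h0 h1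
  have hopen : IsOpen {q : ℝ × ℝ | 0 < q.1 ∧ 0 < q.2 ∧ c * q.2 < c * ρ + (c - ρ) * q.1 ∧
      c * q.1 < c * ρ + (c - ρ) * q.2} :=
    (isOpen_lt continuous_const continuous_fst).inter <|
      (isOpen_lt continuous_const continuous_snd).inter <|
      (isOpen_lt (f := fun q : ℝ × ℝ => c * q.2) (g := fun q => c * ρ + (c - ρ) * q.1)
        (by fun_prop) (by fun_prop)).inter <|
      isOpen_lt (f := fun q : ℝ × ℝ => c * q.1) (g := fun q => c * ρ + (c - ρ) * q.2)
        (by fun_prop) (by fun_prop)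
  refine mem_interior.2 ⟨_, ?_, hopen, hx, hy, ?_, ?_⟩
  · rintro ⟨a, b⟩ ⟨ha, hb, hab, hba⟩
    simp only at ha hb hab hba
    rcases le_total a b with h | h
    · exact (convex_lambdaSet ρ).mem_of_le_of_mem_triangle (zero_mem_lambdaSet ρ) h0
        (by linarith) (zero_rho_mem_lambdaSet hirr h0 h1) hcmem ha.le h hab.le
    · rw [← swap_image_lambdaSet]
      exact ⟨(b, a), (convex_lambdaSet ρ).mem_of_le_of_mem_triangle (zero_mem_lambdaSet ρ) h0
        (by linarith) (zero_rho_mem_lambdaSet hirr h0 h1) hcmem hb.le h hba.le, rfl⟩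
  · nlinarith
  · nlinarith

theorem eq_endpoint_of_accPt_extremePoints {ρ : ℝ} (hirr : Irrational ρ) (h0 : 0 < ρ)
    (h1 : ρ < 1) {x : ℝ × ℝ} (hx : AccPt x (𝓟 ((LambdaSet ρ).extremePoints ℝ))) :
    x = ((0 : ℝ), ρ) ∨ x = (ρ, (0 : ℝ)) := by
  obtain ⟨hx1, hx2, hx3⟩ := mem_quadrantBand_of_accPt h0 hx
  have hsum : x.1 + x.2 = ρ := by linarith [abs_nonpos_iff.1 hx3]
  rcases hx1.eq_or_lt with h | h
  · exact Or.inl (Prod.ext h.symm (by simp only; linarith))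
  rcases hx2.eq_or_lt with h' | h'
  · exact Or.inr (Prod.ext (by simp only; linarith) h'.symm)
  obtain ⟨y, ⟨hy, hye⟩, -⟩ := accPt_iff_nhds.1 hx _
    (isOpen_interior.mem_nhds (mem_interior_lambdaSet hirr h0 h1 h h' hsum))
  exact absurd hye (disjoint_left.1 (disjoint_interior_extremePoints (LambdaSet ρ)) hy)

theorem vecRho_fst_le {ρ : ℝ} {m : ℕ} (h0 : 0 < ρ) (hm : alphaSeq ρ m < ρ) (n : ℕ) :
    (vecRho ρ m n).1 ≤ ρ := by
  rw [vecRho_eq, div_le_iff₀ (by positivity)]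
  have : 0 ≤ (n : ℝ) * ρ := by positivity
  linarith

/-- On the generators, `(0, ρ)` lies strictly above a line through it of slope `u - 1`, provided
`u ⌈mρ⌉` bounds every admissible `α_m`. -/
theorem snd_lt_of_mem_lambdaGenerators {ρ u : ℝ} (h0 : 0 < ρ)
    (hu : ∀ m : ℕ, alphaSeq ρ m < ρ → alphaSeq ρ m ≤ u * ⌈(m : ℝ) * ρ⌉) {p : ℝ × ℝ}
    (hp : p ∈ lambdaGenerators ρ) : p.2 < ρ + (u - 1) * p.1 := by
  rcases hp with rfl | ⟨m, n, hm, hn, rfl⟩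
  · simpa using h0
  have h := hu m hm
  rw [ceil_eq_add_alphaSeq] at h
  have hD : (0 : ℝ) < (m : ℝ) + n + 1 := by positivity
  rw [vecRho_eq]
  simp only
  rw [div_lt_iff₀ hD, add_mul, mul_assoc, div_mul_cancel₀ _ hD.ne']
  linarith

theorem alphaSeq_le_of_forall_snd_le {ρ u : ℝ} (hirr : Irrational ρ) (h0 : 0 < ρ) (h1 : ρ < 1)
    (h : ∀ p ∈ LambdaSet ρ, p.2 ≤ ρ + (u - 1) * p.1) {m : ℕ} (hm : alphaSeq ρ m < ρ) :
    alphaSeq ρ m ≤ u * ⌈(m : ℝ) * ρ⌉ := by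
  by_contra! hlt
  obtain ⟨n, hn, hn'⟩ := exists_alphaSeq_mem_Ioo hirr h1
    (le_max_right (ρ - (alphaSeq ρ m - u * ⌈(m : ℝ) * ρ⌉)) 0) (max_lt (by linarith) h0)
  have hn2 := (le_max_left _ _).trans_lt hn
  have hD : (0 : ℝ) < (m : ℝ) + n + 1 := by positivity
  have hle := h _ (vecRho_mem_lambdaSet hm hn')
  rw [vecRho_eq] at hle
  simp only at hle
  rw [div_le_iff₀ hD, add_mul, mul_assoc, div_mul_cancel₀ _ hD.ne'] at hle
  rw [ceil_eq_add_alphaSeq] at hn2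
  linarith

theorem exists_least_slope {ρ : ℝ} (hirr : Irrational ρ) (h0 : 0 < ρ) (h1 : ρ < 1) :
    ∃ u : ℝ, 0 < u ∧ IsLeast {u : ℝ | ∀ m : ℕ, alphaSeq ρ m < ρ →
      alphaSeq ρ m ≤ u * ⌈(m : ℝ) * ρ⌉} u := by
  set W : Set ℝ := {u | ∀ m : ℕ, alphaSeq ρ m < ρ → alphaSeq ρ m ≤ u * ⌈(m : ℝ) * ρ⌉} with hW
  have hclosed : IsClosed W := by
    simp only [hW, ofPred_forall]
    exact isClosed_iInter fun m => isClosed_iInter fun _ =>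
      isClosed_le continuous_const (by fun_prop)
  have hone : (1 : ℝ) ∈ W := fun m _ => by
    rw [ceil_eq_add_alphaSeq]
    have : 0 ≤ (m : ℝ) * ρ := by positivity
    linarith
  obtain ⟨m, hm, hm'⟩ := exists_alphaSeq_mem_Ioo hirr h1 le_rfl h0
  have hceil : (0 : ℝ) < ⌈(m : ℝ) * ρ⌉ := by
    rw [ceil_eq_add_alphaSeq]
    positivity
  have hpos : ∀ u ∈ W, 0 < u := fun u hu =>
    pos_of_mul_pos_left (hm.trans_le (hu m hm')) hceil.le
  have hbdd : BddBelow W := ⟨0, fun u hu => (hpos u hu).le⟩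
  have hmem := hclosed.csInf_mem ⟨1, hone⟩ hbdd
  exact ⟨sInf W, hpos _ hmem, hmem, fun u hu => csInf_le hbdd hu⟩

theorem accPt_zero_rho {ρ : ℝ} (hirr : Irrational ρ) (h0 : 0 < ρ) (h1 : ρ < 1) :
    AccPt ((0 : ℝ), ρ) (𝓟 ((LambdaSet ρ).extremePoints ℝ)) := by
  by_contra hacc
  obtain ⟨u, hu0, hu, hmin⟩ := exists_least_slope hirr h0 h1
  set K := closure ((LambdaSet ρ).extremePoints ℝ \ {((0 : ℝ), ρ)}) with hK
  have hnotmem : ((0 : ℝ), ρ) ∉ K := fun h =>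
    hacc (accPt_principal_iff_clusterPt.2 (mem_closure_iff_clusterPt.1 h))
  have hsub : K ⊆ closure ((LambdaSet ρ).extremePoints ℝ) := closure_mono sdiff_subset
  have hKcomp : IsCompact K := (isCompact_lambdaSet h0).of_isClosed_subset isClosed_closure
    (hsub.trans (closure_minimal extremePoints_subset isClosed_closure))
  have hpos : ∀ p ∈ K, 0 < ρ + (u - 1) * p.1 - p.2 := by
    intro p hp
    rcases closure_extremePoints_lambdaSet_subset h0 (hsub hp) with h | ⟨hx, hy, hxy⟩
    · linarith [snd_lt_of_mem_lambdaGenerators h0 hu h]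
    · have hsum : p.1 + p.2 = ρ := by linarith [abs_nonpos_iff.1 hxy]
      have hx' : 0 < p.1 := hx.lt_of_ne fun h =>
        hnotmem (by rwa [show ((0 : ℝ), ρ) = p from Prod.ext h (by simp only; linarith)])
      nlinarith
  obtain ⟨δ, hδ, hle⟩ := hKcomp.exists_forall_le'
    (f := fun p : ℝ × ℝ => ρ + (u - 1) * p.1 - p.2) (by fun_prop) hpos
  have hfst : ∀ p ∈ LambdaSet ρ, p.1 ≤ 1 := by
    refine fun p hp => (closure_minimal (convexHull_min ?_ ?_) ?_ :
      LambdaSet ρ ⊆ {p | p.1 ≤ 1}) hp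
    · rintro p (rfl | ⟨m, n, hm, hn, rfl⟩)
      · simp
      · exact (vecRho_fst_le h0 hm n).trans h1.le
    · exact convex_halfSpace_le (LinearMap.fst ℝ ℝ ℝ).isLinear 1
    · exact isClosed_le continuous_fst continuous_const
  have hhalf : ∀ p ∈ LambdaSet ρ, p.2 ≤ ρ + (u - δ - 1) * p.1 := by
    rw [← closure_convexHull_extremePoints (isCompact_lambdaSet h0) (convex_lambdaSet ρ)]
    refine fun p hp => (closure_minimal (convexHull_min ?_ ?_) ?_ :
      _ ⊆ {p : ℝ × ℝ | p.2 ≤ ρ + (u - δ - 1) * p.1}) hp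
    · intro p hp
      by_cases hpe : p = ((0 : ℝ), ρ)
      · simp [hpe]
      · have h2 := hle p (subset_closure ⟨hp, hpe⟩)
        have h3 := hfst p hp.1
        simp only [mem_ofPred_eq] at h2 ⊢
        nlinarith
    · rintro ⟨x, y⟩ hp ⟨x', y'⟩ hp' a b ha hb hab
      obtain rfl : b = 1 - a := by linarith
      simp only [mem_ofPred_eq, Prod.smul_mk, Prod.mk_add_mk, smul_eq_mul] at hp hp' ⊢
      nlinarith [mul_le_mul_of_nonneg_left hp ha, mul_le_mul_of_nonneg_left hp' hb]
    · exact isClosed_le continuous_snd (by fun_prop)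
  have := hmin fun m hm => alphaSeq_le_of_forall_snd_le hirr h0 h1 hhalf hm
  linarith

theorem accPt_rho_zero {ρ : ℝ} (hirr : Irrational ρ) (h0 : 0 < ρ) (h1 : ρ < 1) :
    AccPt (ρ, (0 : ℝ)) (𝓟 ((LambdaSet ρ).extremePoints ℝ)) := by
  have h := (accPt_zero_rho hirr h0 h1).map (f := Prod.swap) continuous_swap.continuousAt
    Prod.swap_injective
  have himg := image_extremePoints (𝕜 := ℝ) (LinearEquiv.prodComm ℝ ℝ ℝ) (LambdaSet ρ)
  have e : ⇑(LinearEquiv.prodComm ℝ ℝ ℝ) = Prod.swap := rfl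
  rw [e, swap_image_lambdaSet] at himg
  rwa [map_principal, himg] at h

theorem stmt4 (ρ : ℝ) (hirr : Irrational ρ) (h0 : 0 < ρ) (h1 : ρ < 1) :
    AccPt (((0 : ℝ), ρ)) (𝓟 (Set.extremePoints ℝ (LambdaSet ρ))) ∧
    AccPt ((ρ, (0 : ℝ))) (𝓟 (Set.extremePoints ℝ (LambdaSet ρ))) ∧
    ∀ x : ℝ × ℝ, AccPt x (𝓟 (Set.extremePoints ℝ (LambdaSet ρ))) →
      x = ((0 : ℝ), ρ) ∨ x = (ρ, (0 : ℝ)) := by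
  exact ⟨accPt_zero_rho hirr h0 h1, accPt_rho_zero hirr h0 h1,
    fun _ hx => eq_endpoint_of_accPt_extremePoints hirr h0 h1 hx⟩
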